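/- There exist constants D > 1 and κ > 0 such that for every τ ∈ (0,1) and every 𝐚 ∈ Z̄(τ), one has D⁻¹·log(1/τ) − κ ≤ |𝐚| ≤ D·log(1/τ) + κ. -/

import Mathlib

open MeasureTheory

/-- `SL(2,ℝ)`. -/
abbrev SL2 : Type := Matrix.SpecialLinearGroup (Fin 2) ℝ

/-- The Möbius transformation of `g ∈ SL(2,ℝ)` acting on `ℂ` (junk at the pole). -/
noncomputable def mobiusC (g : SL2) (z : ℂ) : ℂ :=
  ((g.1 0 0 : ℂ) * z + (g.1 0 1 : ℂ)) / ((g.1 1 0 : ℂ) * z + (g.1 1 1 : ℂ))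

/-- The Möbius transformation of `g ∈ SL(2,ℝ)` acting on `ℝ` (junk at the pole). -/
noncomputable def mobiusR (g : SL2) (x : ℝ) : ℝ :=
  (g.1 0 0 * x + g.1 0 1) / (g.1 1 0 * x + g.1 1 1)

/-- The derivative `γ'(z) = (uz+v)⁻²` of the Möbius transformation of `g`. -/
noncomputable def mobiusDerivC (g : SL2) (z : ℂ) : ℂ :=
  ((g.1 1 0 : ℂ) * z + (g.1 1 1 : ℂ))⁻¹ ^ 2

/-- The derivative `γ'(x) = (ux+v)⁻²` of the Möbius transformation of `g`, real version. -/
noncomputable def mobiusDerivR (g : SL2) (x : ℝ) : ℝ :=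
  (g.1 1 0 * x + g.1 1 1)⁻¹ ^ 2

/-- The Möbius transformation of `g ∈ SL(2,ℝ)` acting on the Riemann sphere `ℂ ∪ {∞}`. -/
noncomputable def mobiusS (g : SL2) (z : OnePoint ℂ) : OnePoint ℂ :=
  Option.elim z
    (if (g.1 1 0 : ℝ) = 0 then OnePoint.infty else (((g.1 0 0 / g.1 1 0 : ℝ) : ℂ) : OnePoint ℂ))
    (fun w => if ((g.1 1 0 : ℂ) * w + (g.1 1 1 : ℂ)) = 0 then OnePoint.infty
      else ((mobiusC g w : ℂ) : OnePoint ℂ))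

/-- The involution `a ↦ ā = a + r mod 2r` on the alphabet `𝒜 = Fin (2r)`. -/
def wordBar {r : ℕ} (a : Fin (2 * r)) : Fin (2 * r) :=
  ⟨(a.1 + r) % (2 * r), Nat.mod_lt _ (Nat.lt_of_le_of_lt (Nat.zero_le _) a.isLt)⟩

/-- A word: a finite sequence of letters with no adjacent letter equal to the bar of the
previous one. -/
def IsWord {r : ℕ} (w : List (Fin (2 * r))) : Prop :=
  w.Chain' (fun x y => x ≠ wordBar y)

/-- The mirror word `𝐚̄ = (ā_n, …, ā_1)`. -/
def mirror {r : ℕ} (w : List (Fin (2 * r))) : List (Fin (2 * r)) :=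
  (w.map wordBar).reverse

/-- `𝐚 → 𝐛` : either word is empty, or the last letter of `𝐚` is not the bar of the first
letter of `𝐛`. -/
def arrow {r : ℕ} (w v : List (Fin (2 * r))) : Prop :=
  ∀ x ∈ w.getLast?, ∀ y ∈ v.head?, x ≠ wordBar y

/-- `𝐚 ⇝ 𝐛` : both words are nonempty and the last letter of `𝐚` equals the first letter
of `𝐛`. -/
def wiggly {r : ℕ} (w v : List (Fin (2 * r))) : Prop :=
  w ≠ [] ∧ v ≠ [] ∧ w.getLast? = v.head?

/-- Schottky data: pairwise disjoint closed discs centered on the real line, paired by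
elements of `SL(2,ℝ)`. -/
structure Schottky where
  r : ℕ
  two_le_r : 2 ≤ r
  center : Fin (2 * r) → ℝ
  radius : Fin (2 * r) → ℝ
  radius_pos : ∀ a, 0 < radius a
  g : Fin (2 * r) → SL2
  disjoint : ∀ a b : Fin (2 * r), a ≠ b →
    Disjoint (closure (Metric.ball ((center a : ℂ)) (radius a)))
             (closure (Metric.ball ((center b : ℂ)) (radius b)))
  g_bar : ∀ a : Fin (2 * r), g (wordBar a) = (g a)⁻¹
  maps : ∀ a : Fin (2 * r),
    mobiusS (g a) '' (((fun w : ℂ => (w : OnePoint ℂ)) ''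
        Metric.ball ((center (wordBar a) : ℂ)) (radius (wordBar a)))ᶜ)
      = (fun w : ℂ => (w : OnePoint ℂ)) '' closure (Metric.ball ((center a : ℂ)) (radius a))

namespace Schottky

variable (S : Schottky)

/-- The open disc `D_a`. -/
def D (a : Fin (2 * S.r)) : Set ℂ := Metric.ball ((S.center a : ℂ)) (S.radius a)

/-- The union `𝐃` of the open discs. -/
def Dall : Set ℂ := ⋃ a, S.D a

/-- The open interval `I_a = D_a ∩ ℝ`. -/
def Ireal (a : Fin (2 * S.r)) : Set ℝ := {x : ℝ | (x : ℂ) ∈ S.D a}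

/-- The union `I` of the intervals `I_a`. -/
def Iall : Set ℝ := ⋃ a, S.Ireal a

/-- The group element `γ_𝐚 = γ_{a₁} ⋯ γ_{a_n}` associated to a word. -/
noncomputable def wprod (w : List (Fin (2 * S.r))) : SL2 := (w.map S.g).prod

/-- The Schottky group `Γ`, generated by the `γ_a`. -/
def SGroup : Subgroup SL2 := Subgroup.closure (Set.range S.g)

theorem wprod_mem (w : List (Fin (2 * S.r))) : S.wprod w ∈ S.SGroup := by
  apply Subgroup.list_prod_mem
  intro x hx
  obtain ⟨a, -, rfl⟩ := List.mem_map.mp hx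
  exact Subgroup.subset_closure ⟨a, rfl⟩

/-- `γ_𝐚` as an element of the Schottky group `Γ`. -/
noncomputable def wprodG (w : List (Fin (2 * S.r))) : S.SGroup := ⟨S.wprod w, S.wprod_mem w⟩

/-- The generator `γ_a` as an element of `Γ`. -/
noncomputable def genG (a : Fin (2 * S.r)) : S.SGroup :=
  ⟨S.g a, Subgroup.subset_closure ⟨a, rfl⟩⟩

/-- The interval `I_𝐚 = γ_{𝐚'}(I_{a_n})` of a nonempty word. -/
noncomputable def Iset (w : List (Fin (2 * S.r))) : Set ℝ :=
  if h : w = [] then ∅ else mobiusR (S.wprod w.dropLast) '' S.Ireal (w.getLast h)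

/-- `Υ_𝐚 = |I_𝐚|`, the length of the interval `I_𝐚`; `Υ_∅ = 1`. -/
noncomputable def ups (w : List (Fin (2 * S.r))) : ℝ :=
  if w = [] then 1 else (volume (S.Iset w)).toReal

/-- The Bourgain–Dyatlov partition `Z(τ)`. -/
def Zset (τ : ℝ) : Set (List (Fin (2 * S.r))) :=
  {w | IsWord w ∧ w ≠ [] ∧ S.ups w ≤ τ ∧ τ < S.ups w.dropLast}

/-- The mirror set `Z̄(τ) = {𝐚 ∈ 𝒲 : 𝐚̄ ∈ Z(τ)}`. -/
def Zbar (τ : ℝ) : Set (List (Fin (2 * S.r))) :=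
  {w | IsWord w ∧ mirror w ∈ S.Zset τ}

open Classical in
/-- The Bowen–Series map on the Riemann sphere (junk value `∞` off `𝐃`). -/
noncomputable def TS (z : OnePoint ℂ) : OnePoint ℂ :=
  if h : ∃ a : Fin (2 * S.r), ∃ w : ℂ, z = (w : OnePoint ℂ) ∧ w ∈ S.D a
  then mobiusS (S.g h.choose)⁻¹ z
  else OnePoint.infty

/-- The limit set `Λ`: points of `𝐃` all of whose forward iterates under the Bowen–Series
map are defined (finite) and remain in `𝐃`. -/
def limitSet : Set ℂ :=
  {z : ℂ | ∀ n : ℕ, ∃ w : ℂ, (S.TS)^[n] (z : OnePoint ℂ) = (w : OnePoint ℂ) ∧ w ∈ S.Dall}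

/-- The limit set, viewed inside `ℝ`. -/
def limitSetR : Set ℝ := {x : ℝ | (x : ℂ) ∈ S.limitSet}

/-- `δ`, the Hausdorff dimension of the limit set. -/
noncomputable def delta : ℝ := (dimH S.limitSet).toReal

/-- `PowerPairs(τ)`: pairs `(𝐚,𝐛) ∈ Z̄(τ)²` such that `γ_{𝐚'}γ_{𝐛'}⁻¹` is a nontrivial
proper power in `Γ`. -/
def PowerPairs (τ : ℝ) : Set (List (Fin (2 * S.r)) × List (Fin (2 * S.r))) :=
  {p | p.1 ∈ S.Zbar τ ∧ p.2 ∈ S.Zbar τ ∧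
    S.wprod p.1.dropLast * (S.wprod p.2.dropLast)⁻¹ ≠ 1 ∧
    ∃ γ₀ ∈ S.SGroup, ∃ q : ℕ, 2 ≤ q ∧
      S.wprod p.1.dropLast * (S.wprod p.2.dropLast)⁻¹ = (γ₀ : SL2) ^ q}

end Schottky

/-- Finitely many reals admit a common upper bound `M ≥ 1`. -/
theorem exists_one_le_upper_bound {ι : Type*} [Finite ι] (f : ι → ℝ) :
    ∃ M : ℝ, 1 ≤ M ∧ ∀ i, f i ≤ M := by
  obtain ⟨M, hM⟩ := (Set.finite_range f).bddAbove
  exact ⟨max 1 M, le_max_left _ _, fun i => le_max_of_le_right (hM ⟨i, rfl⟩)⟩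

theorem wordBar_wordBar {r : ℕ} (a : Fin (2 * r)) : wordBar (wordBar a) = a := by
  have ha := a.isLt
  apply Fin.ext
  simp only [wordBar]
  rw [Nat.mod_add_mod, show a.1 + r + r = a.1 + 2 * r by ring, Nat.add_mod_right,
    Nat.mod_eq_of_lt ha]

theorem isWord_append_singleton {r : ℕ} {w : List (Fin (2 * r))} {b : Fin (2 * r)} :
    IsWord (w ++ [b]) ↔ IsWord w ∧ ∀ l ∈ w.getLast?, l ≠ wordBar b := by
  rw [IsWord, List.Chain', List.isChain_append]
  simp [IsWord, List.Chain']

/-- The difference of two values of a Möbius transformation. -/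
theorem mobiusR_sub (g : SL2) {x y : ℝ} (hx : g.1 1 0 * x + g.1 1 1 ≠ 0)
    (hy : g.1 1 0 * y + g.1 1 1 ≠ 0) :
    mobiusR g y - mobiusR g x
      = (y - x) / ((g.1 1 0 * x + g.1 1 1) * (g.1 1 0 * y + g.1 1 1)) := by
  have hdet : g.1 0 0 * g.1 1 1 - g.1 0 1 * g.1 1 0 = 1 := by
    rw [← Matrix.det_fin_two]; exact g.2
  unfold mobiusR
  rw [div_sub_div _ _ hy hx, div_eq_div_iff (mul_ne_zero hy hx) (mul_ne_zero hx hy)]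
  linear_combination ((y - x) * (g.1 1 0 * x + g.1 1 1) * (g.1 1 0 * y + g.1 1 1)) * hdet

/-- Composition of Möbius transformations away from the poles. -/
theorem mobiusR_mul (g h : SL2) {x : ℝ} (hx : h.1 1 0 * x + h.1 1 1 ≠ 0) :
    mobiusR (g * h) x = mobiusR g (mobiusR h x) := by
  simp only [mobiusR, Matrix.SpecialLinearGroup.coe_mul, Matrix.mul_apply, Fin.sum_univ_two]
  rw [← mul_div_mul_right (g.1 0 0 * _ + g.1 0 1) _ hx]
  congr 1 <;> field_simp <;> ring

theorem continuousOn_mobiusR (g : SL2) {s : Set ℝ}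
    (h : ∀ x ∈ s, g.1 1 0 * x + g.1 1 1 ≠ 0) : ContinuousOn (mobiusR g) s := by
  unfold mobiusR
  exact ContinuousOn.div (by fun_prop) (by fun_prop) h

theorem injOn_mobiusR (g : SL2) {s : Set ℝ}
    (h : ∀ x ∈ s, g.1 1 0 * x + g.1 1 1 ≠ 0) : Set.InjOn (mobiusR g) s := by
  intro x hx y hy hxy
  have := mobiusR_sub g (h x hx) (h y hy)
  rw [hxy, sub_self, eq_comm, div_eq_zero_iff] at this
  rcases this with h1 | h1
  · linarith
  · exact absurd h1 (mul_ne_zero (h x hx) (h y hy))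

/-- A Möbius transformation without pole on `[p,q]` has denominators of constant sign there. -/
theorem mobius_denom_mul_pos (g : SL2) {p q : ℝ}
    (h : ∀ x ∈ Set.Icc p q, g.1 1 0 * x + g.1 1 1 ≠ 0) {x y : ℝ} (hx : x ∈ Set.Icc p q)
    (hy : y ∈ Set.Icc p q) : 0 < (g.1 1 0 * x + g.1 1 1) * (g.1 1 0 * y + g.1 1 1) := by
  by_contra hcon
  have hcont : ContinuousOn (fun t => g.1 1 0 * t + g.1 1 1) (Set.Icc p q) := by fun_prop
  have hconv := isPreconnected_Icc.image _ hcont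
  have hord := hconv.ordConnected
  have hmem : (0 : ℝ) ∈ (fun t => g.1 1 0 * t + g.1 1 1) '' Set.Icc p q := by
    rcases le_total (g.1 1 0 * x + g.1 1 1) 0 with h1 | h1
    · refine hord.out ⟨x, hx, rfl⟩ ⟨y, hy, rfl⟩ ⟨h1, ?_⟩
      by_contra h2
      exact hcon (mul_pos_of_neg_of_neg (lt_of_le_of_ne h1 (h x hx)) (not_le.mp h2))
    · refine hord.out ⟨y, hy, rfl⟩ ⟨x, hx, rfl⟩ ⟨?_, h1⟩
      by_contra h2
      exact hcon (mul_pos (lt_of_le_of_ne h1 (h x hx).symm) (not_le.mp h2))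
  obtain ⟨t, ht, h0⟩ := hmem
  exact h t ht h0

theorem mobiusR_image_Icc (g : SL2) {p q : ℝ} (hpq : p ≤ q)
    (h : ∀ x ∈ Set.Icc p q, g.1 1 0 * x + g.1 1 1 ≠ 0) :
    mobiusR g '' Set.Icc p q = Set.Icc (mobiusR g p) (mobiusR g q) := by
  have hmono : MonotoneOn (mobiusR g) (Set.Icc p q) := by
    intro x hx y hy hxy
    have h1 := mobiusR_sub g (h x hx) (h y hy)
    have h2 : 0 ≤ (y - x) / ((g.1 1 0 * x + g.1 1 1) * (g.1 1 0 * y + g.1 1 1)) :=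
      div_nonneg (by linarith) (mobius_denom_mul_pos g h hx hy).le
    linarith
  exact (continuousOn_mobiusR g h).image_Icc_of_monotoneOn hpq hmono

theorem volume_mobiusR_image_Icc (g : SL2) {p q : ℝ} (hpq : p ≤ q)
    (h : ∀ x ∈ Set.Icc p q, g.1 1 0 * x + g.1 1 1 ≠ 0) :
    volume (mobiusR g '' Set.Icc p q)
      = ENNReal.ofReal ((q - p) / ((g.1 1 0 * p + g.1 1 1) * (g.1 1 0 * q + g.1 1 1))) := by
  have hp : p ∈ Set.Icc p q := ⟨le_rfl, hpq⟩
  have hq : q ∈ Set.Icc p q := ⟨hpq, le_rfl⟩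
  rw [mobiusR_image_Icc g hpq h, Real.volume_Icc, mobiusR_sub g (h p hp) (h q hq)]

theorem volume_mobiusR_image_Ioo (g : SL2) {p q : ℝ} :
    volume (mobiusR g '' Set.Ioo p q) = volume (mobiusR g '' Set.Icc p q) := by
  refine le_antisymm (measure_mono (Set.image_mono Set.Ioo_subset_Icc_self)) ?_
  have hsub : mobiusR g '' Set.Icc p q
      ⊆ mobiusR g '' Set.Ioo p q ∪ mobiusR g '' {p, q} := by
    rw [← Set.image_union]
    refine Set.image_mono fun x hx => ?_
    rcases hx.1.eq_or_lt with h1 | h1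
    · exact Or.inr (Or.inl h1.symm)
    rcases hx.2.eq_or_lt with h2 | h2
    · exact Or.inr (Or.inr h2)
    · exact Or.inl ⟨h1, h2⟩
  have hfin : volume (mobiusR g '' {p, q}) = 0 :=
    ((Set.toFinite {p, q}).image _).measure_zero _
  calc _ ≤ _ := measure_mono hsub
    _ ≤ _ := measure_union_le _ _
    _ = _ := by rw [hfin, add_zero]

namespace Schottky

variable (S : Schottky)

/-- The closed interval `closure D_a ∩ ℝ`. -/
def J (a : Fin (2 * S.r)) : Set ℝ := Set.Icc (S.center a - S.radius a) (S.center a + S.radius a)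

theorem Ireal_eq (a : Fin (2 * S.r)) :
    S.Ireal a = Set.Ioo (S.center a - S.radius a) (S.center a + S.radius a) := by
  ext x
  have h : dist (x : ℂ) (S.center a : ℂ) = |x - S.center a| := by
    rw [dist_eq_norm, ← Complex.ofReal_sub, Complex.norm_real, Real.norm_eq_abs]
  simp only [Ireal, D, Set.mem_ofPred_eq, Metric.mem_ball, h, abs_lt, Set.mem_Ioo]
  constructor <;> rintro ⟨h1, h2⟩ <;> constructor <;> linarith

theorem mem_J {a : Fin (2 * S.r)} {x : ℝ} : x ∈ S.J a ↔ |x - S.center a| ≤ S.radius a := by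
  simp only [J, Set.mem_Icc, abs_le]
  constructor <;> rintro ⟨h1, h2⟩ <;> constructor <;> linarith

theorem radius_add_lt {a b : Fin (2 * S.r)} (hab : a ≠ b) :
    S.radius a + S.radius b < |S.center a - S.center b| := by
  have h := S.disjoint a b hab
  rw [closure_ball _ (S.radius_pos a).ne', closure_ball _ (S.radius_pos b).ne',
    disjoint_closedBall_closedBall_iff (S.radius_pos a).le (S.radius_pos b).le, dist_eq_norm,
    ← Complex.ofReal_sub, Complex.norm_real, Real.norm_eq_abs] at h
  exact h

/-- The closed intervals `J a` are uniformly separated and uniformly bounded. -/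
theorem exists_gap : ∃ m X : ℝ, 0 < m ∧ 1 ≤ X ∧ (∀ a, ∀ x ∈ S.J a, |x| ≤ X) ∧
    ∀ a b, a ≠ b → ∀ x ∈ S.J a, ∀ y ∈ S.J b, m ≤ |x - y| := by
  obtain ⟨X, hX1, hX⟩ := exists_one_le_upper_bound fun a => |S.center a| + S.radius a
  obtain ⟨M, hM1, hM⟩ := exists_one_le_upper_bound fun p : Fin (2 * S.r) × Fin (2 * S.r) =>
    (|S.center p.1 - S.center p.2| - S.radius p.1 - S.radius p.2)⁻¹
  refine ⟨M⁻¹, X, by positivity, hX1, fun a x hx => ?_, fun a b hab x hx y hy => ?_⟩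
  · have h1 := S.mem_J.mp hx
    have h2 := abs_add_le (x - S.center a) (S.center a)
    rw [sub_add_cancel] at h2
    have := hX a
    linarith
  · have hpos := S.radius_add_lt hab
    have h1 := S.mem_J.mp hx
    have h2 := S.mem_J.mp hy
    have h3 := abs_add_three (S.center a - x) (x - y) (y - S.center b)
    rw [show S.center a - x + (x - y) + (y - S.center b) = S.center a - S.center b by ring,
      abs_sub_comm (S.center a) x] at h3
    have h4 := inv_le_of_inv_le₀ (by linarith) (hM (a, b))
    simp only at h4
    linarith

/-- In homogeneous coordinates, `γ_a` maps the real points outside `D_ā` into `J a`. -/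
theorem map_homogeneous (a : Fin (2 * S.r)) {x y : ℝ} (hxy : x ≠ 0 ∨ y ≠ 0)
    (hout : y ≠ 0 → S.radius (wordBar a) ≤ |x / y - S.center (wordBar a)|) :
    (S.g a).1 1 0 * x + (S.g a).1 1 1 * y ≠ 0 ∧
      ((S.g a).1 0 0 * x + (S.g a).1 0 1 * y) / ((S.g a).1 1 0 * x + (S.g a).1 1 1 * y)
        ∈ S.J a := by
  have key : ∀ z : OnePoint ℂ, (∀ w : ℂ, z = w → S.radius (wordBar a) ≤
      dist w (S.center (wordBar a))) → ∃ w : ℂ, mobiusS (S.g a) z = w ∧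
        dist w (S.center a) ≤ S.radius a := by
    intro z hz
    have hmem : mobiusS (S.g a) z ∈ mobiusS (S.g a) '' (((fun w : ℂ => (w : OnePoint ℂ)) ''
        Metric.ball ((S.center (wordBar a) : ℂ)) (S.radius (wordBar a)))ᶜ) := by
      refine ⟨z, ?_, rfl⟩
      rintro ⟨w, hw, rfl⟩
      exact absurd (hz w rfl) (not_le.mpr hw)
    rw [S.maps a, closure_ball _ (S.radius_pos a).ne'] at hmem
    obtain ⟨w, hw, hw'⟩ := hmem
    exact ⟨w, hw'.symm, hw⟩
  have hdist : ∀ s t : ℝ, dist (s : ℂ) (t : ℂ) = |s - t| := fun s t => by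
    rw [dist_eq_norm, ← Complex.ofReal_sub, Complex.norm_real, Real.norm_eq_abs]
  by_cases hy : y = 0
  · subst hy
    have hx : x ≠ 0 := by tauto
    obtain ⟨w, hw, hw'⟩ := key OnePoint.infty fun w h => absurd h.symm (OnePoint.coe_ne_infty w)
    change (if (S.g a).1 1 0 = 0 then OnePoint.infty else
      ((((S.g a).1 0 0 / (S.g a).1 1 0 : ℝ) : ℂ) : OnePoint ℂ)) = _ at hw
    split_ifs at hw with h0
    · exact absurd hw.symm (OnePoint.coe_ne_infty w)
    · have hw2 := OnePoint.coe_injective hw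
      subst hw2
      rw [hdist] at hw'
      refine ⟨by simpa using ⟨h0, hx⟩, S.mem_J.mpr ?_⟩
      rwa [mul_zero, mul_zero, add_zero, add_zero, mul_div_mul_right _ _ hx]
  · obtain ⟨w, hw, hw'⟩ := key (((x / y : ℝ) : ℂ) : OnePoint ℂ) fun w h => by
      have h2 := OnePoint.coe_injective h
      rw [← h2, hdist]
      exact hout hy
    change (if (((S.g a).1 1 0 : ℂ) * ((x / y : ℝ) : ℂ) + ((S.g a).1 1 1 : ℂ)) = 0 then
      OnePoint.infty else ((mobiusC (S.g a) ((x / y : ℝ) : ℂ) : ℂ) : OnePoint ℂ)) = _ at hw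
    split_ifs at hw with h0
    · exact absurd hw.symm (OnePoint.coe_ne_infty w)
    · have h0' : (S.g a).1 1 0 * (x / y) + (S.g a).1 1 1 ≠ 0 := by exact_mod_cast h0
      have hw2 := OnePoint.coe_injective hw
      have hw3 : mobiusC (S.g a) ((x / y : ℝ) : ℂ) = ((mobiusR (S.g a) (x / y) : ℝ) : ℂ) := by
        simp only [mobiusC, mobiusR]
        push_cast
        rfl
      rw [← hw2, hw3, hdist] at hw'
      have e1 : (S.g a).1 1 0 * x + (S.g a).1 1 1 * y
          = ((S.g a).1 1 0 * (x / y) + (S.g a).1 1 1) * y := by field_simp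
      have e2 : (S.g a).1 0 0 * x + (S.g a).1 0 1 * y
          = ((S.g a).1 0 0 * (x / y) + (S.g a).1 0 1) * y := by field_simp
      rw [e1, e2, mul_div_mul_right _ _ hy]
      exact ⟨mul_ne_zero h0' hy, S.mem_J.mpr hw'⟩

theorem radius_le_of_mem_J {a b : Fin (2 * S.r)} (hab : a ≠ b) {x : ℝ} (hx : x ∈ S.J a) :
    S.radius b ≤ |x - S.center b| := by
  have h1 := S.mem_J.mp hx
  have h2 := S.radius_add_lt hab
  have h3 := abs_add_le (S.center a - x) (x - S.center b)
  rw [sub_add_sub_cancel, abs_sub_comm (S.center a) x] at h3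
  linarith

theorem mobiusR_g_mem_J {a b : Fin (2 * S.r)} (hab : a ≠ wordBar b) {x : ℝ} (hx : x ∈ S.J b) :
    (S.g a).1 1 0 * x + (S.g a).1 1 1 ≠ 0 ∧ mobiusR (S.g a) x ∈ S.J a := by
  have hba : b ≠ wordBar a := fun h => hab (by rw [h, wordBar_wordBar])
  have h := S.map_homogeneous a (x := x) (y := 1) (Or.inr one_ne_zero) fun _ => by
    rw [div_one]; exact S.radius_le_of_mem_J hba hx
  simp only [mul_one] at h
  exact h

theorem wprod_append_singleton (w : List (Fin (2 * S.r))) (b : Fin (2 * S.r)) :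
    S.wprod (w ++ [b]) = S.wprod w * S.g b := by
  simp [wprod]

/-- The pole of `γ_𝐚` lies in the closed interval of the bar of the last letter of `𝐚`. -/
theorem pole_mem_J (w : List (Fin (2 * S.r))) (hw : IsWord w) (l : Fin (2 * S.r))
    (hl : l ∈ w.getLast?) : (S.wprod w).1 1 0 ≠ 0 ∧
      -(S.wprod w).1 1 1 / (S.wprod w).1 1 0 ∈ S.J (wordBar l) := by
  induction w using List.reverseRecOn generalizing l with
  | nil => simp at hl
  | append_singleton w b ih =>
    obtain rfl : b = l := by simpa using hl
    obtain ⟨hw1, hw2⟩ := isWord_append_singleton.mp hw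
    have hg := S.g_bar b
    have e : ∀ i j, (S.g (wordBar b)).1 i j = ((S.g b)⁻¹).1 i j := fun i j => by rw [hg]
    simp only [Matrix.SpecialLinearGroup.coe_inv, Matrix.adjugate_fin_two] at e
    have hdet : (S.wprod w).1 0 0 * (S.wprod w).1 1 1 - (S.wprod w).1 0 1 * (S.wprod w).1 1 0
        = 1 := by
      rw [← Matrix.det_fin_two]; exact (S.wprod w).2
    have h := S.map_homogeneous (wordBar b) (x := (S.wprod w).1 1 1) (y := -(S.wprod w).1 1 0)
      (by
        by_contra! hcon
        rw [hcon.1, neg_eq_zero.mp hcon.2] at hdet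
        simp at hdet)
      (by
        intro hc
        rw [wordBar_wordBar]
        rcases hlast : w.getLast? with _ | l
        · rw [List.getLast?_eq_none_iff] at hlast
          subst hlast
          simp [wprod] at hc
        · have hl' := hw2 l hlast
          have h1 := (ih hw1 l hlast).2
          rw [div_neg, ← neg_div]
          exact S.radius_le_of_mem_J (fun h => hl' (by rw [← h, wordBar_wordBar])) h1)
    rw [e 0 0, e 0 1, e 1 0, e 1 1] at h
    simp only [Matrix.of_apply, Matrix.cons_val', Matrix.cons_val_zero, Matrix.cons_val_one,
      Matrix.cons_val_fin_one] at h
    rw [wprod_append_singleton]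
    simp only [Matrix.SpecialLinearGroup.coe_mul, Matrix.mul_apply, Fin.sum_univ_two]
    have e1 : -(S.g b).1 1 0 * (S.wprod w).1 1 1 + (S.g b).1 0 0 * -(S.wprod w).1 1 0
      = -((S.wprod w).1 1 0 * (S.g b).1 0 0 + (S.wprod w).1 1 1 * (S.g b).1 1 0) := by ring
    have e2 : (S.g b).1 1 1 * (S.wprod w).1 1 1 + -(S.g b).1 0 1 * -(S.wprod w).1 1 0
      = ((S.wprod w).1 1 0 * (S.g b).1 0 1 + (S.wprod w).1 1 1 * (S.g b).1 1 1) := by ring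
    rw [e1, e2, div_neg, ← neg_div] at h
    exact ⟨neg_ne_zero.mp h.1, h.2⟩

/-- Bounded distortion: the denominators of `γ_𝐚` at points of the intervals `J b` with
`𝐚 → b` are nonzero and uniformly comparable. -/
theorem exists_denom_le : ∃ K : ℝ, 1 ≤ K ∧ ∀ w : List (Fin (2 * S.r)), ∀ b b',
    IsWord (w ++ [b]) → IsWord (w ++ [b']) → ∀ x ∈ S.J b, ∀ y ∈ S.J b',
      (S.wprod w).1 1 0 * x + (S.wprod w).1 1 1 ≠ 0 ∧
      |(S.wprod w).1 1 0 * x + (S.wprod w).1 1 1|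
        ≤ K * |(S.wprod w).1 1 0 * y + (S.wprod w).1 1 1| := by
  obtain ⟨m, X, hm, hX1, hX, hgap⟩ := S.exists_gap
  refine ⟨max 1 (2 * X / m), le_max_left _ _, fun w b b' hb hb' x hx y hy => ?_⟩
  rcases hlast : w.getLast? with _ | l
  · rw [List.getLast?_eq_none_iff] at hlast
    subst hlast
    simp [wprod]
  · obtain ⟨hw, hlb⟩ := isWord_append_singleton.mp hb
    have hlb := hlb l hlast
    have hlb' := (isWord_append_singleton.mp hb').2 l hlast
    obtain ⟨hc, hpole⟩ := S.pole_mem_J w hw l hlast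
    set c := (S.wprod w).1 1 0
    set d := (S.wprod w).1 1 1
    have hfac : ∀ t, c * t + d = c * (t - -d / c) := fun t => by field_simp; ring
    have hgx := hgap b (wordBar l) (fun h => hlb (by rw [h, wordBar_wordBar])) x hx _ hpole
    have hgy := hgap b' (wordBar l) (fun h => hlb' (by rw [h, wordBar_wordBar])) y hy _ hpole
    have hup : |x - -d / c| ≤ 2 * X := by
      have := abs_sub x (-d / c)
      have := hX _ _ hx
      have := hX _ _ hpole
      linarith
    rw [hfac x, hfac y, abs_mul, abs_mul]
    refine ⟨mul_ne_zero hc (abs_pos.mp (hm.trans_le hgx)), ?_⟩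
    have h1 : |x - -d / c| ≤ max 1 (2 * X / m) * |y - -d / c| := by
      calc |x - -d / c| ≤ 2 * X := hup
        _ = 2 * X / m * m := by field_simp
        _ ≤ _ := by gcongr; exact le_max_right _ _
    calc |c| * |x - -d / c| ≤ |c| * (max 1 (2 * X / m) * |y - -d / c|) := by gcongr
      _ = _ := by ring

theorem denom_ne_zero {w : List (Fin (2 * S.r))} {b : Fin (2 * S.r)} (h : IsWord (w ++ [b])) :
    ∀ x ∈ S.J b, (S.wprod w).1 1 0 * x + (S.wprod w).1 1 1 ≠ 0 := by
  obtain ⟨K, -, hK⟩ := S.exists_denom_le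
  exact fun x hx => (hK w b b h h x hx x hx).1

theorem ups_append_singleton (w : List (Fin (2 * S.r))) (b : Fin (2 * S.r)) :
    S.ups (w ++ [b]) = (volume (mobiusR (S.wprod w) '' S.Ireal b)).toReal := by
  simp [ups, Iset]

theorem ups_eq_volume_J (w : List (Fin (2 * S.r))) (b : Fin (2 * S.r)) :
    S.ups (w ++ [b]) = (volume (mobiusR (S.wprod w) '' S.J b)).toReal := by
  rw [ups_append_singleton, Ireal_eq,
    volume_mobiusR_image_Ioo, J]

theorem ups_formula {w : List (Fin (2 * S.r))} {b : Fin (2 * S.r)} (h : IsWord (w ++ [b])) :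
    S.ups (w ++ [b]) = 2 * S.radius b /
      (|(S.wprod w).1 1 0 * (S.center b - S.radius b) + (S.wprod w).1 1 1| *
        |(S.wprod w).1 1 0 * (S.center b + S.radius b) + (S.wprod w).1 1 1|) := by
  have hr := S.radius_pos b
  have hle : S.center b - S.radius b ≤ S.center b + S.radius b := by linarith
  have hpos := mobius_denom_mul_pos (S.wprod w) (S.denom_ne_zero h)
    (Set.left_mem_Icc.mpr hle) (Set.right_mem_Icc.mpr hle)
  rw [ups_eq_volume_J, J, volume_mobiusR_image_Icc _ hle (S.denom_ne_zero h),
    ← abs_mul, abs_of_pos hpos, ENNReal.toReal_ofReal (by apply div_nonneg; linarith; exact hpos.le)]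
  congr 1
  ring

theorem left_mem_J (b : Fin (2 * S.r)) : S.center b - S.radius b ∈ S.J b :=
  Set.left_mem_Icc.mpr (by linarith [S.radius_pos b])

theorem right_mem_J (b : Fin (2 * S.r)) : S.center b + S.radius b ∈ S.J b :=
  Set.right_mem_Icc.mpr (by linarith [S.radius_pos b])

theorem ups_pos {w : List (Fin (2 * S.r))} {b : Fin (2 * S.r)} (h : IsWord (w ++ [b])) :
    0 < S.ups (w ++ [b]) := by
  have h1 := abs_pos.mpr (S.denom_ne_zero h _ (S.left_mem_J b))
  have h2 := abs_pos.mpr (S.denom_ne_zero h _ (S.right_mem_J b))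
  have h3 := S.radius_pos b
  rw [ups_formula S h]
  positivity

/-- Sibling intervals have comparable lengths. -/
theorem exists_ups_le_sibling : ∃ K : ℝ, 1 ≤ K ∧ ∀ w : List (Fin (2 * S.r)), ∀ b b',
    IsWord (w ++ [b]) → IsWord (w ++ [b']) → S.ups (w ++ [b]) ≤ K * S.ups (w ++ [b']) := by
  obtain ⟨K, hK1, hK⟩ := S.exists_denom_le
  obtain ⟨M, hM1, hM⟩ := exists_one_le_upper_bound fun p : Fin (2 * S.r) × Fin (2 * S.r) =>
    S.radius p.1 / S.radius p.2
  refine ⟨M * (K * K), by nlinarith, fun w b b' hb hb' => ?_⟩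
  have hl := S.denom_ne_zero hb _ (S.left_mem_J b)
  have hr := S.denom_ne_zero hb _ (S.right_mem_J b)
  have h1 := (hK w b' b hb' hb _ (S.left_mem_J b') _ (S.left_mem_J b)).2
  have h2 := (hK w b' b hb' hb _ (S.right_mem_J b') _ (S.right_mem_J b)).2
  have hl' := S.denom_ne_zero hb' _ (S.left_mem_J b')
  have hr' := S.denom_ne_zero hb' _ (S.right_mem_J b')
  have hM' := hM (b, b')
  simp only at hM'
  rw [div_le_iff₀ (S.radius_pos b')] at hM'
  rw [ups_formula S hb, ups_formula S hb']
  rw [← abs_pos] at hl hr hl' hr'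
  set A := |(S.wprod w).1 1 0 * (S.center b - S.radius b) + (S.wprod w).1 1 1|
  set B := |(S.wprod w).1 1 0 * (S.center b + S.radius b) + (S.wprod w).1 1 1|
  set A' := |(S.wprod w).1 1 0 * (S.center b' - S.radius b') + (S.wprod w).1 1 1|
  set B' := |(S.wprod w).1 1 0 * (S.center b' + S.radius b') + (S.wprod w).1 1 1|
  rw [← mul_div_assoc, div_le_div_iff₀ (by positivity) (by positivity)]
  have hrb := S.radius_pos b
  have hrb' := S.radius_pos b'
  calc 2 * S.radius b * (A' * B') ≤ 2 * (M * S.radius b') * ((K * A) * (K * B)) := by gcongr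
    _ = _ := by ring

/-- Two sibling intervals fit disjointly in their parent. -/
theorem ups_add_ups_le {w : List (Fin (2 * S.r))} {l b b' : Fin (2 * S.r)} (hbb : b ≠ b')
    (hb : IsWord (w ++ [l] ++ [b])) (hb' : IsWord (w ++ [l] ++ [b'])) :
    S.ups (w ++ [l] ++ [b]) + S.ups (w ++ [l] ++ [b']) ≤ S.ups (w ++ [l]) := by
  have hsub : ∀ e, IsWord (w ++ [l] ++ [e]) → mobiusR (S.wprod (w ++ [l])) '' S.J e
      = mobiusR (S.wprod w) '' (mobiusR (S.g l) '' S.J e) ∧ mobiusR (S.g l) '' S.J e ⊆ S.J l := by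
    intro e he
    have hle : l ≠ wordBar e := (isWord_append_singleton.mp he).2 l (by simp)
    constructor
    · rw [Set.image_image, wprod_append_singleton]
      exact Set.image_congr fun x hx => mobiusR_mul _ _ (S.mobiusR_g_mem_J hle hx).1
    · rintro _ ⟨x, hx, rfl⟩
      exact (S.mobiusR_g_mem_J hle hx).2
  have hl : IsWord (w ++ [l]) := (isWord_append_singleton.mp hb).1
  have hne : ∀ e, IsWord (w ++ [l] ++ [e]) →
      ∀ x ∈ S.J e, (S.g l).1 1 0 * x + (S.g l).1 1 1 ≠ 0 := fun e he x hx =>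
    (S.mobiusR_g_mem_J ((isWord_append_singleton.mp he).2 l (by simp)) hx).1
  have hdisjJ : Disjoint (S.J b) (S.J b') := by
    rw [Set.disjoint_left]
    intro x hx hx'
    have h1 := S.radius_le_of_mem_J hbb hx
    have h2 := S.mem_J.mp hx
    have h3 := S.mem_J.mp hx'
    have h4 := S.radius_add_lt hbb
    have h5 := abs_add_le (S.center b - x) (x - S.center b')
    rw [sub_add_sub_cancel, abs_sub_comm (S.center b) x] at h5
    linarith
  have hdisj : Disjoint (mobiusR (S.wprod (w ++ [l])) '' S.J b)
      (mobiusR (S.wprod (w ++ [l])) '' S.J b') := by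
    rw [(hsub b hb).1, (hsub b' hb').1, Set.disjoint_left]
    rintro _ ⟨_, ⟨x, hx, rfl⟩, rfl⟩ ⟨_, ⟨y, hy, rfl⟩, hxy⟩
    have h1 := injOn_mobiusR (S.wprod w) (S.denom_ne_zero hl)
      ((hsub b' hb').2 ⟨y, hy, rfl⟩) ((hsub b hb).2 ⟨x, hx, rfl⟩) hxy
    have h2 : y = x := injOn_mobiusR (S.g l) (s := S.J b ∪ S.J b')
      (fun t ht => ht.elim (hne b hb t) (hne b' hb' t)) (Or.inr hy) (Or.inl hx) h1
    exact Set.disjoint_left.mp hdisjJ hx (h2 ▸ hy)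
  have hmeas : MeasurableSet (mobiusR (S.wprod (w ++ [l])) '' S.J b') := by
    rw [J, mobiusR_image_Icc _ (by linarith [S.radius_pos b']) (S.denom_ne_zero hb')]
    exact measurableSet_Icc
  have hfin : ∀ {v : List (Fin (2 * S.r))} {e}, IsWord (v ++ [e]) →
      volume (mobiusR (S.wprod v) '' S.J e) ≠ ⊤ := by
    intro v e he
    rw [J, volume_mobiusR_image_Icc _ (by linarith [S.radius_pos e]) (S.denom_ne_zero he)]
    exact ENNReal.ofReal_ne_top
  rw [ups_eq_volume_J, ups_eq_volume_J, ups_eq_volume_J,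
    ← ENNReal.toReal_add (hfin hb) (hfin hb'), ← measure_union hdisj hmeas]
  refine ENNReal.toReal_mono (hfin hl) (measure_mono (Set.union_subset ?_ ?_))
  · rw [(hsub b hb).1]
    exact Set.image_mono (hsub b hb).2
  · rw [(hsub b' hb').1]
    exact Set.image_mono (hsub b' hb').2

/-- Interval lengths decay at least exponentially in the word length. -/
theorem exists_ups_le_pow : ∃ θ R : ℝ, 0 < θ ∧ θ < 1 ∧ 0 < R ∧
    ∀ (w : List (Fin (2 * S.r))) (b), IsWord (w ++ [b]) →
      S.ups (w ++ [b]) ≤ R * θ ^ w.length := by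
  obtain ⟨K, hK1, hK⟩ := S.exists_ups_le_sibling
  obtain ⟨R, hR1, hR⟩ := exists_one_le_upper_bound fun b => S.ups [b]
  have hK0 : 0 < K := by linarith
  refine ⟨K / (K + 1), R, by positivity, by rw [div_lt_one (by positivity)]; linarith,
    by linarith, fun w => ?_⟩
  induction w using List.reverseRecOn with
  | nil => intro b _; simpa using hR b
  | append_singleton w l ih =>
    intro b hb
    obtain ⟨hl, hlb⟩ := isWord_append_singleton.mp hb
    obtain ⟨b', hb'⟩ : ∃ b', b' ∉ ({b, wordBar l} : Finset (Fin (2 * S.r))) := by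
      by_contra! hall
      have h1 := Finset.card_le_card (fun x _ => hall x : Finset.univ ⊆ {b, wordBar l})
      have h2 := Finset.card_le_two (a := b) (b := wordBar l)
      have h3 := S.two_le_r
      rw [Finset.card_univ, Fintype.card_fin] at h1
      omega
    simp only [Finset.mem_insert, Finset.mem_singleton, not_or] at hb'
    have hwb' : IsWord (w ++ [l] ++ [b']) := by
      refine isWord_append_singleton.mpr ⟨hl, fun l' hl' h => hb'.2 ?_⟩
      obtain rfl : l = l' := by simpa using hl'
      rw [h, wordBar_wordBar]
    have h1 := hK (w ++ [l]) b b' hb hwb'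
    have h2 := S.ups_add_ups_le (Ne.symm hb'.1) hb hwb'
    have h3 : S.ups (w ++ [l] ++ [b]) ≤ K / (K + 1) * S.ups (w ++ [l]) := by
      rw [div_mul_eq_mul_div, le_div_iff₀ (by positivity)]
      nlinarith
    rw [List.length_append, List.length_singleton, pow_succ]
    calc _ ≤ _ := h3
      _ ≤ K / (K + 1) * (R * (K / (K + 1)) ^ w.length) := by gcongr; exact ih l hl
      _ = _ := by ring

/-- Interval lengths decay at most exponentially in the word length. -/
theorem exists_le_ups_mul_pow : ∃ B c : ℝ, 1 < B ∧ 0 < c ∧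
    ∀ (w : List (Fin (2 * S.r))) (b), IsWord (w ++ [b]) →
      c ≤ S.ups (w ++ [b]) * B ^ w.length := by
  obtain ⟨m, X, hm, hX1, hX, -⟩ := S.exists_gap
  obtain ⟨B, hB1, hB⟩ := exists_one_le_upper_bound fun p : Fin (2 * S.r) × Fin 2 =>
    |(S.g p.1).1 p.2 0| + |(S.g p.1).1 p.2 1|
  obtain ⟨M, hM1, hM⟩ := exists_one_le_upper_bound fun b => (S.radius b)⁻¹
  have hrow : ∀ w : List (Fin (2 * S.r)),
      |(S.wprod w).1 1 0| + |(S.wprod w).1 1 1| ≤ (2 * B) ^ w.length := by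
    intro w
    induction w using List.reverseRecOn with
    | nil => simp [wprod]
    | append_singleton w b ih =>
      have h0 := hB (b, 0)
      have h1 := hB (b, 1)
      simp only at h0 h1
      rw [wprod_append_singleton, List.length_append, List.length_singleton, pow_succ]
      simp only [Matrix.SpecialLinearGroup.coe_mul, Matrix.mul_apply, Fin.sum_univ_two]
      set c := (S.wprod w).1 1 0
      set d := (S.wprod w).1 1 1
      have e0 := abs_add_le (c * (S.g b).1 0 0) (d * (S.g b).1 1 0)
      have e1 := abs_add_le (c * (S.g b).1 0 1) (d * (S.g b).1 1 1)
      simp only [abs_mul] at e0 e1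
      have f0 := mul_le_mul_of_nonneg_left h0 (abs_nonneg c)
      have f1 := mul_le_mul_of_nonneg_left h1 (abs_nonneg d)
      have f2 : (|c| + |d|) * B ≤ (2 * B) ^ w.length * B := by gcongr
      have f3 : 0 ≤ (2 * B) ^ w.length * B := by positivity
      linarith
  have hden : ∀ (w : List (Fin (2 * S.r))) (b), ∀ x ∈ S.J b,
      |(S.wprod w).1 1 0 * x + (S.wprod w).1 1 1| ≤ X * (2 * B) ^ w.length := by
    intro w b x hx
    have h1 := abs_add_le ((S.wprod w).1 1 0 * x) ((S.wprod w).1 1 1)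
    rw [abs_mul] at h1
    have h2 := mul_le_mul_of_nonneg_left (hX b x hx) (abs_nonneg ((S.wprod w).1 1 0))
    have h3 := mul_le_mul_of_nonneg_left (hrow w) (by linarith : 0 ≤ X)
    have h4 := mul_le_mul_of_nonneg_right hX1 (abs_nonneg ((S.wprod w).1 1 1))
    linarith
  refine ⟨(2 * B) ^ 2, 2 * M⁻¹ / (X * X), by nlinarith, by positivity, fun w b hb => ?_⟩
  have h1 := abs_pos.mpr (S.denom_ne_zero hb _ (S.left_mem_J b))
  have h2 := abs_pos.mpr (S.denom_ne_zero hb _ (S.right_mem_J b))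
  have h3 := hden w b _ (S.left_mem_J b)
  have h4 := hden w b _ (S.right_mem_J b)
  have h5 : M⁻¹ ≤ S.radius b := inv_le_of_inv_le₀ (S.radius_pos b) (hM b)
  rw [ups_formula S hb, div_mul_eq_mul_div, div_le_div_iff₀ (by positivity) (by positivity)]
  have h6 := mul_le_mul h3 h4 h2.le (by positivity)
  calc _ ≤ 2 * S.radius b * (X * (2 * B) ^ w.length * (X * (2 * B) ^ w.length)) := by
        have := S.radius_pos b
        gcongr
    _ = _ := by rw [← pow_mul]; ring

end Schottky


/-- there are `D > 1`, `κ > 0` such that every `𝐚 ∈ Z̄(τ)` has word length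
between `D⁻¹ log(1/τ) − κ` and `D log(1/τ) + κ`, for every `τ ∈ (0,1)`. -/
theorem stmt_6 (S : Schottky) :
    ∃ D κ : ℝ, 1 < D ∧ 0 < κ ∧
      ∀ τ : ℝ, 0 < τ → τ < 1 →
        ∀ w ∈ S.Zbar τ,
          D⁻¹ * Real.log τ⁻¹ - κ ≤ (w.length : ℝ) ∧
          (w.length : ℝ) ≤ D * Real.log τ⁻¹ + κ := by
  obtain ⟨θ, R, hθ0, hθ1, hR0, hup⟩ := S.exists_ups_le_pow
  obtain ⟨B, c, hB1, hc0, hlow⟩ := S.exists_le_ups_mul_pow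
  have hα : 0 < Real.log θ⁻¹ := Real.log_pos (one_lt_inv_iff₀.mpr ⟨hθ0, hθ1⟩)
  have hβ : 0 < Real.log B := Real.log_pos hB1
  set α := Real.log θ⁻¹
  set β := Real.log B
  refine ⟨2 + α⁻¹ + β, 2 + α⁻¹ * |Real.log R| + |Real.log c|, by linarith [inv_pos.mpr hα],
    by positivity, ?_⟩
  intro τ hτ0 hτ1 w hw
  obtain ⟨-, hword, hne, hle, hlt⟩ := hw
  have hL : 0 < Real.log τ⁻¹ := Real.log_pos (one_lt_inv_iff₀.mpr ⟨hτ0, hτ1⟩)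
  have hlen : (mirror w).length = w.length := by simp [mirror]
  rw [← hlen]
  generalize mirror w = v at *
  obtain ⟨u, b, rfl⟩ : ∃ u b, v = u ++ [b] :=
    ⟨_, _, (List.dropLast_append_getLast hne).symm⟩
  rw [List.dropLast_concat] at hlt
  have hD : 0 < 2 + α⁻¹ + β := by positivity
  rw [List.length_append, List.length_singleton]
  push_cast
  set n : ℝ := (u.length : ℝ) with hn
  have hn0 : 0 ≤ n := Nat.cast_nonneg _
  constructor
  · have h1 : c ≤ τ * B ^ u.length := (hlow u b hword).trans (by gcongr)
    have h2 := Real.log_le_log hc0 h1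
    rw [Real.log_mul hτ0.ne' (by positivity), Real.log_pow] at h2
    have h3 : Real.log τ⁻¹ ≤ n * β + |Real.log c| := by
      rw [Real.log_inv]
      linarith [neg_abs_le (Real.log c)]
    have h4 : (2 + α⁻¹ + β)⁻¹ * Real.log τ⁻¹ ≤ n + |Real.log c| := by
      rw [inv_mul_le_iff₀ hD]
      have : 0 ≤ (2 + α⁻¹) * n := by positivity
      have : 0 ≤ (1 + α⁻¹ + β) * |Real.log c| := by positivity
      linarith
    have : 0 ≤ α⁻¹ * |Real.log R| := by positivity
    linarith
  · have h0 : 0 ≤ α⁻¹ * |Real.log R| := by positivity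
    have h0' : 0 ≤ |Real.log c| := abs_nonneg _
    have h0'' : 0 ≤ (2 + β) * Real.log τ⁻¹ := by positivity
    suffices h : n ≤ 1 + α⁻¹ * |Real.log R| + α⁻¹ * Real.log τ⁻¹ by linarith
    rcases List.eq_nil_or_concat u with rfl | ⟨t, l, hu⟩
    · have : n = 0 := by simp [hn]
      have : 0 ≤ α⁻¹ * Real.log τ⁻¹ := by positivity
      linarith
    · rw [List.concat_eq_append] at hu
      have h1 := (hu ▸ hlt).trans_le
        (hup t l (hu ▸ (isWord_append_singleton.mp hword).1))
      have h2 := Real.log_le_log hτ0 h1.le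
      rw [Real.log_mul hR0.ne' (by positivity), Real.log_pow] at h2
      have h3 : n = t.length + 1 := by simp [hn, hu]
      have h4 : (t.length : ℝ) * α ≤ |Real.log R| + Real.log τ⁻¹ := by
        have : α = -Real.log θ := Real.log_inv θ
        rw [Real.log_inv, this]
        linarith [le_abs_self (Real.log R)]
      have h5 : (t.length : ℝ) ≤ α⁻¹ * (|Real.log R| + Real.log τ⁻¹) := by
        rw [le_inv_mul_iff₀ hα]
        linarith
      linarith
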